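/- If a graph cycle A belongs to both E^k and E^{k+1}, then H_m^{k+1}(A) = H_e^{k+1}(A) = H_e^k(A). Consequently, for every graph cycle A ≠ S, H_e^k(A) = H_e(A) for every k with A ∈ E^k. -/

import Mathlib

open scoped ENNReal

namespace MetropolisCycles

variable {S : Type*} [Fintype S] [DecidableEq S]

/-- A path: a finite sequence of states whose consecutive members communicate. -/
def IsPath (q : S → S → ℝ) (ω : List S) : Prop :=
  ω.Chain' (fun a b => 0 < q a b)

/-- `x` and `y` are joined by a path entirely contained in `G`. -/
def JoinedIn (q : S → S → ℝ) (G : Set S) (x y : S) : Prop :=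
  ∃ ω : List S, ω.head? = some x ∧ ω.getLast? = some y ∧ IsPath q ω ∧ ∀ z ∈ ω, z ∈ G

/-- `G` is connected: any two of its points are joined by a path inside `G`. -/
def IsConnectedSet (q : S → S → ℝ) (G : Set S) : Prop :=
  ∀ x ∈ G, ∀ y ∈ G, JoinedIn q G x y

/-- The exterior boundary `∂G`. -/
def extBoundary (q : S → S → ℝ) (G : Set S) : Set S :=
  {y | y ∉ G ∧ ∃ x ∈ G, 0 < q x y}

/-- `A` is a non-trivial path cycle: connected and `max_A H < min_{∂A} H`. -/
def IsNontrivialPathCycle (H : S → ℝ) (q : S → S → ℝ) (A : Set S) : Prop :=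
  A.Nonempty ∧ IsConnectedSet q A ∧ ∀ x ∈ A, ∀ y ∈ extBoundary q A, H x < H y

/-- `A` is a path cycle: a singleton or a non-trivial path cycle. -/
def IsPathCycle (H : S → ℝ) (q : S → S → ℝ) (A : Set S) : Prop :=
  (∃ x, A = {x}) ∨ IsNontrivialPathCycle H q A

/-- The set of points joined to `x` by a path whose points all have energy at most `c`. -/
def energyCut (H : S → ℝ) (q : S → S → ℝ) (c : ℝ) (x : S) : Set S :=
  {y | JoinedIn q {z | H z ≤ c} x y}

/-- `U_{≤ x}`: the points joined to `x` by a path with energies at most `H x`. -/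
def Ule (H : S → ℝ) (q : S → S → ℝ) (x : S) : Set S := energyCut H q (H x) x

/-- The total cost of a path of cycles with respect to a cost function `Vs`. -/
noncomputable def listCost (Vs : Set S → Set S → ℝ≥0∞) : List (Set S) → ℝ≥0∞
  | [] => 0
  | [_] => 0
  | B :: B' :: l => Vs B B' + listCost Vs (B' :: l)

/-- `H_e` relative to a level `(E, V)` of the construction:
`H_e(A) = min { V(A,A') : A' ∈ E, A' ≠ A }`. -/
noncomputable def HeAux (E : Set (Set S)) (V : Set S → Set S → ℝ≥0∞) (A : Set S) : ℝ≥0∞ :=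
  ⨅ A' ∈ E \ {A}, V A A'

/-- The renormalized cost function `V_* (A,B) = V(A,B) - H_e(A)`. -/
noncomputable def VsAux (E : Set (Set S)) (V : Set S → Set S → ℝ≥0∞) (A B : Set S) : ℝ≥0∞ :=
  V A B - HeAux E V A

/-- `A →_k A'`: some path of elements of `E` from `A` to `A'` has zero total `V_*`-cost. -/
def arrowAux (E : Set (Set S)) (V : Set S → Set S → ℝ≥0∞) (A A' : Set S) : Prop :=
  ∃ l : List (Set S), l.head? = some A ∧ l.getLast? = some A' ∧ (∀ B ∈ l, B ∈ E) ∧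
    listCost (VsAux E V) l = 0

/-- The set `D^{k+1}`: unions of the `R_k`-equivalence classes. -/
def DAux (E : Set (Set S)) (V : Set S → Set S → ℝ≥0∞) : Set (Set S) :=
  {B | ∃ A ∈ E, B = ⋃₀ {A' | A' ∈ E ∧ arrowAux E V A A' ∧ arrowAux E V A' A}}

/-- The order relation `≥^{k+1}` on `D^{k+1}`. -/
def geqAux (E : Set (Set S)) (V : Set S → Set S → ℝ≥0∞) (B B' : Set S) : Prop :=
  ∃ C ∈ E, ∃ C' ∈ E, C ⊆ B ∧ C' ⊆ B' ∧ arrowAux E V C C'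

/-- `D_*^{k+1}`: the minimal elements of `D^{k+1}` for `≥^{k+1}`. -/
def DstarAux (E : Set (Set S)) (V : Set S → Set S → ℝ≥0∞) : Set (Set S) :=
  {B ∈ DAux E V | ∀ B' ∈ DAux E V, geqAux E V B B' → B' = B}

/-- `E^{k+1}` built from `(E^k, V^k)`. -/
def EnextAux (E : Set (Set S)) (V : Set S → Set S → ℝ≥0∞) : Set (Set S) :=
  DstarAux E V ∪ {A | A ∈ E ∧ ∃ B ∈ DAux E V \ DstarAux E V, A ⊆ B}

/-- `H_m^{k+1}(A) = max { H_e^k(A') : A' ∈ E^k, A' ⊆ A }`. -/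
noncomputable def HmAux (E : Set (Set S)) (V : Set S → Set S → ℝ≥0∞) (A : Set S) : ℝ≥0∞ :=
  ⨆ A' ∈ {A' | A' ∈ E ∧ A' ⊆ A}, HeAux E V A'

/-- `V^{k+1}(A,A') = H_m^{k+1}(A) + min { V_*^k(B,B') : B,B' ∈ E^k, B ⊆ A, B' ⊆ A' }`. -/
noncomputable def VnextAux (E : Set (Set S)) (V : Set S → Set S → ℝ≥0∞) (A A' : Set S) : ℝ≥0∞ :=
  HmAux E V A + ⨅ B ∈ {B | B ∈ E ∧ B ⊆ A}, ⨅ B' ∈ {B' | B' ∈ E ∧ B' ⊆ A'}, VsAux E V B B'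

/-- The zero-order cost function `V^0({i},{j}) = (H j - H i)⁺` if `q i j > 0`, `∞` otherwise
(and `∞` on non-singletons). -/
noncomputable def V0 (H : S → ℝ) (q : S → S → ℝ) (A B : Set S) : ℝ≥0∞ :=
  ⨅ i ∈ A, ⨅ j ∈ B, ⨅ _ : A = {i} ∧ B = {j} ∧ 0 < q i j, ENNReal.ofReal (H j - H i)

/-- The recursive construction `k ↦ (E^k, V^k)`. -/
noncomputable def cycEV (H : S → ℝ) (q : S → S → ℝ) : ℕ → Set (Set S) × (Set S → Set S → ℝ≥0∞)
  | 0 => ({A | ∃ i, A = {i}}, V0 H q)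
  | k + 1 => (EnextAux (cycEV H q k).1 (cycEV H q k).2,
              VnextAux (cycEV H q k).1 (cycEV H q k).2)

/-- The `k`-th order set of graph cycles `E^k`. -/
noncomputable def Ecyc (H : S → ℝ) (q : S → S → ℝ) (k : ℕ) : Set (Set S) := (cycEV H q k).1

/-- The `k`-th order cost function `V^k`. -/
noncomputable def Vcyc (H : S → ℝ) (q : S → S → ℝ) (k : ℕ) : Set S → Set S → ℝ≥0∞ :=
  (cycEV H q k).2

/-- `H_e^k(A)`. -/
noncomputable def Hek (H : S → ℝ) (q : S → S → ℝ) (k : ℕ) (A : Set S) : ℝ≥0∞ :=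
  HeAux (Ecyc H q k) (Vcyc H q k) A

/-- `H_m^k(A)` (defined for `k ≥ 1`; set to `0` at `k = 0`). -/
noncomputable def Hmk (H : S → ℝ) (q : S → S → ℝ) : ℕ → Set S → ℝ≥0∞
  | 0 => fun _ => 0
  | k + 1 => fun A => HmAux (Ecyc H q k) (Vcyc H q k) A

/-- `D^{n+1}` (indexed by `n`). -/
noncomputable def Dcyc (H : S → ℝ) (q : S → S → ℝ) (n : ℕ) : Set (Set S) :=
  DAux (Ecyc H q n) (Vcyc H q n)

/-- `D_*^{n+1}` (indexed by `n`). -/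
noncomputable def DstarCyc (H : S → ℝ) (q : S → S → ℝ) (n : ℕ) : Set (Set S) :=
  DstarAux (Ecyc H q n) (Vcyc H q n)

/-- The set of graph cycles `C = ∪_k E^k`. -/
def GraphCycles (H : S → ℝ) (q : S → S → ℝ) : Set (Set S) := {A | ∃ k, A ∈ Ecyc H q k}

/-- `H_e(A) = sup { H_e^k(A) : k ≥ 0, A ∈ E^k }` (for a graph cycle `A ≠ S`). -/
noncomputable def HeC (H : S → ℝ) (q : S → S → ℝ) (A : Set S) : ℝ≥0∞ :=
  ⨆ k, ⨆ _ : A ∈ Ecyc H q k, Hek H q k A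

/-- `H_m(A) = max( sup { H_e(B) : B ∈ C, B ⊆ A, B ≠ A }, 0 )` (for `|A| > 1`). -/
noncomputable def HmC (H : S → ℝ) (q : S → S → ℝ) (A : Set S) : ℝ≥0∞ :=
  ⨆ B ∈ {B | B ∈ GraphCycles H q ∧ B ⊆ A ∧ B ≠ A}, HeC H q B

theorem listCost_append_tail {α : Type*} (W : Set α → Set α → ℝ≥0∞) (b : Set α)
    (l l' : List (Set α)) (hl : l.getLast? = some b) (hl' : l'.head? = some b) :
    listCost W (l ++ l'.tail) = listCost W l + listCost W l' := by
  obtain ⟨t, rfl⟩ : ∃ t, l' = b :: t := by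
    cases l' with
    | nil => simp at hl'
    | cons c t => exact ⟨t, by simpa using hl'⟩
  induction l with
  | nil => simp at hl
  | cons a l ih =>
    cases l with
    | nil =>
      obtain rfl : a = b := by simpa using hl
      simp [listCost]
    | cons c l =>
      have := ih (by simpa using hl)
      simp only [List.cons_append, List.tail_cons, listCost] at this ⊢
      rw [this, add_assoc]

theorem arrowAux_refl {α : Type*} {E : Set (Set α)} {V : Set α → Set α → ℝ≥0∞} {A : Set α}
    (hA : A ∈ E) : arrowAux E V A A :=
  ⟨[A], rfl, rfl, by simpa using hA, rfl⟩

theorem arrowAux_trans {α : Type*} {E : Set (Set α)} {V : Set α → Set α → ℝ≥0∞} {A B C : Set α}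
    (hAB : arrowAux E V A B) (hBC : arrowAux E V B C) : arrowAux E V A C := by
  obtain ⟨l, h1, h2, h3, h4⟩ := hAB
  obtain ⟨l', h1', h2', h3', h4'⟩ := hBC
  refine ⟨l ++ l'.tail, ?_, ?_, ?_, ?_⟩
  · simp [List.head?_append, h1]
  · cases l' with
    | nil => simp at h1'
    | cons c t =>
      obtain rfl : c = B := by simpa using h1'
      cases t with
      | nil =>
        obtain rfl : c = C := by simpa using h2'
        simpa using h2
      | cons d t =>
        have h : (d :: t).getLast? = some C := by simpa using h2'
        simp [List.getLast?_append, h]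
  · intro D hD
    rcases List.mem_append.1 hD with hD | hD
    · exact h3 D hD
    · exact h3' D (List.mem_of_mem_tail hD)
  · rw [listCost_append_tail _ B l l' h2 h1', h4, h4', add_zero]

/-- Every member of `F` contains each member of `E` that it meets. -/
def IsCoarserThan {α : Type*} (F E : Set (Set α)) : Prop :=
  ∀ A ∈ F, ∀ C ∈ E, ∀ x ∈ C, x ∈ A → C ⊆ A

theorem eq_of_mem_mem {α : Type*} {E : Set (Set α)} (hE : Setoid.IsPartition E) {A B : Set α}
    (hA : A ∈ E) (hB : B ∈ E) {x : α} (hxA : x ∈ A) (hxB : x ∈ B) : A = B :=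
  (hE.2 x).unique ⟨hA, hxA⟩ ⟨hB, hxB⟩

theorem eq_of_subset {α : Type*} {E : Set (Set α)} (hE : Setoid.IsPartition E) {A B : Set α}
    (hA : A ∈ E) (hB : B ∈ E) (h : A ⊆ B) : A = B := by
  obtain ⟨x, hx⟩ := Setoid.nonempty_of_mem_partition hE hA
  exact eq_of_mem_mem hE hA hB hx (h hx)

theorem isCoarserThan_DAux {α : Type*} {E : Set (Set α)} (V : Set α → Set α → ℝ≥0∞)
    (hE : Setoid.IsPartition E) : IsCoarserThan (DAux E V) E := by
  rintro _ ⟨A, hA, rfl⟩ C hC x hxC ⟨A', hA', hxA'⟩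
  obtain rfl := eq_of_mem_mem hE hC hA'.1 hxC hxA'
  exact Set.subset_sUnion_of_mem hA'

theorem isPartition_DAux {α : Type*} {E : Set (Set α)} (V : Set α → Set α → ℝ≥0∞)
    (hE : Setoid.IsPartition E) : Setoid.IsPartition (DAux E V) := by
  refine ⟨?_, fun x => ?_⟩
  · rintro ⟨A, hA, h⟩
    obtain ⟨x, hx⟩ := Setoid.nonempty_of_mem_partition hE hA
    have hx' : x ∈ (∅ : Set α) := by
      rw [h]
      exact ⟨A, ⟨hA, arrowAux_refl hA, arrowAux_refl hA⟩, hx⟩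
    exact hx'
  · obtain ⟨A, ⟨hA, hxA⟩, -⟩ := hE.2 x
    refine ⟨_, ⟨⟨A, hA, rfl⟩, A, ⟨hA, arrowAux_refl hA, arrowAux_refl hA⟩, hxA⟩, ?_⟩
    rintro _ ⟨⟨B, hB, rfl⟩, B', ⟨hB', hBB', hB'B⟩, hxB'⟩
    obtain rfl := eq_of_mem_mem hE hA hB' hxA hxB'
    congr 1
    ext C
    exact ⟨fun ⟨h, h1, h2⟩ => ⟨h, arrowAux_trans hB'B h1, arrowAux_trans h2 hBB'⟩,
      fun ⟨h, h1, h2⟩ => ⟨h, arrowAux_trans hBB' h1, arrowAux_trans h2 hB'B⟩⟩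

theorem isCoarserThan_EnextAux {α : Type*} {E : Set (Set α)} (V : Set α → Set α → ℝ≥0∞)
    (hE : Setoid.IsPartition E) : IsCoarserThan (EnextAux E V) E := by
  rintro A (hA | ⟨hA, -⟩) C hC x hxC hxA
  · exact isCoarserThan_DAux V hE A hA.1 C hC x hxC hxA
  · exact (eq_of_mem_mem hE hC hA hxC hxA).subset

theorem isPartition_EnextAux {α : Type*} {E : Set (Set α)} (V : Set α → Set α → ℝ≥0∞)
    (hE : Setoid.IsPartition E) : Setoid.IsPartition (EnextAux E V) := by
  have hD := isPartition_DAux V hE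
  refine ⟨?_, fun x => ?_⟩
  · rintro (h | ⟨h, -⟩)
    · exact hD.1 h.1
    · exact hE.1 h
  · obtain ⟨B, ⟨hB, hxB⟩, -⟩ := hD.2 x
    obtain ⟨C, ⟨hC, hxC⟩, -⟩ := hE.2 x
    by_cases hs : B ∈ DstarAux E V
    · refine ⟨B, ⟨Or.inl hs, hxB⟩, ?_⟩
      rintro A ⟨hA | ⟨-, B', hB', hAB'⟩, hxA⟩
      · exact eq_of_mem_mem hD hA.1 hB hxA hxB
      · obtain rfl := eq_of_mem_mem hD hB'.1 hB (hAB' hxA) hxB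
        exact absurd hs hB'.2
    · refine ⟨C, ⟨Or.inr ⟨hC, B, ⟨hB, hs⟩, isCoarserThan_DAux V hE B hB C hC x hxC hxB⟩, hxC⟩, ?_⟩
      rintro A ⟨hA | ⟨hA, -⟩, hxA⟩
      · obtain rfl := eq_of_mem_mem hD hA.1 hB hxA hxB
        exact absurd hA hs
      · exact eq_of_mem_mem hE hA hC hxA hxC

theorem HmAux_eq_HeAux {α : Type*} {E : Set (Set α)} (V : Set α → Set α → ℝ≥0∞)
    (hE : Setoid.IsPartition E) {A : Set α} (hA : A ∈ E) : HmAux E V A = HeAux E V A := by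
  apply le_antisymm
  · refine iSup₂_le ?_
    rintro A' ⟨hA', h⟩
    rw [eq_of_subset hE hA' hA h]
  · exact le_iSup₂_of_le A ⟨hA, subset_rfl⟩ le_rfl

/-- Renormalizing the costs out of `A` and adding back `H_e` recovers `H_e`. -/
theorem HeAux_add_iInf_VsAux {α : Type*} (E : Set (Set α)) (V : Set α → Set α → ℝ≥0∞)
    (A : Set α) : HeAux E V A + ⨅ B ∈ E \ {A}, VsAux E V A B = HeAux E V A := by
  simp only [VsAux, ENNReal.add_iInf]
  conv_rhs => rw [HeAux]
  exact iInf_congr fun B => iInf_congr fun hB => add_tsub_cancel_of_le (iInf₂_le B hB)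

theorem HeAux_EnextAux {α : Type*} {E : Set (Set α)} (V : Set α → Set α → ℝ≥0∞)
    (hE : Setoid.IsPartition E) {A : Set α} (hA : A ∈ E) (hA' : A ∈ EnextAux E V) :
    HeAux (EnextAux E V) (VnextAux E V) A = HeAux E V A := by
  have hF := isPartition_EnextAux V hE
  apply le_antisymm
  · conv_rhs => rw [← HeAux_add_iInf_VsAux E V A]
    simp only [ENNReal.add_iInf]
    refine le_iInf₂ fun B hB => ?_
    obtain ⟨x, hx⟩ := Setoid.nonempty_of_mem_partition hE hB.1
    obtain ⟨A', ⟨hA'F, hxA'⟩, -⟩ := hF.2 x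
    have hne : A' ≠ A := by
      rintro rfl
      exact hB.2 (eq_of_mem_mem hE hB.1 hA hx hxA')
    refine iInf₂_le_of_le A' ⟨hA'F, hne⟩ ?_
    rw [VnextAux, HmAux_eq_HeAux V hE hA]
    gcongr
    exact iInf₂_le_of_le A ⟨hA, subset_rfl⟩ (iInf₂_le B
      ⟨hB.1, isCoarserThan_EnextAux V hE A' hA'F B hB.1 x hx hxA'⟩)
  · refine le_iInf₂ fun A' _ => ?_
    rw [VnextAux, HmAux_eq_HeAux V hE hA]
    exact le_self_add

theorem isPartition_Ecyc {α : Type*} (H : α → ℝ) (q : α → α → ℝ) (k : ℕ) :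
    Setoid.IsPartition (Ecyc H q k) := by
  induction k with
  | zero =>
    refine ⟨?_, fun x => ⟨{x}, ⟨⟨x, rfl⟩, rfl⟩, ?_⟩⟩
    · rintro ⟨i, hi⟩
      exact Set.singleton_ne_empty i hi.symm
    · rintro _ ⟨⟨i, rfl⟩, hx⟩
      rw [Set.mem_singleton_iff.1 hx]
  | succ k ih => exact isPartition_EnextAux _ ih

theorem isCoarserThan_Ecyc {α : Type*} (H : α → ℝ) (q : α → α → ℝ) {k m : ℕ} (hkm : k ≤ m) :
    IsCoarserThan (Ecyc H q m) (Ecyc H q k) := by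
  induction m, hkm using Nat.le_induction with
  | base =>
    intro A hA C hC x hxC hxA
    exact (eq_of_mem_mem (isPartition_Ecyc H q k) hC hA hxC hxA).subset
  | succ m _ ih =>
    intro A hA C hC x hxC hxA
    obtain ⟨B, ⟨hB, hxB⟩, -⟩ := (isPartition_Ecyc H q m).2 x
    exact (ih B hB C hC x hxC hxB).trans
      (isCoarserThan_EnextAux _ (isPartition_Ecyc H q m) A hA B hB x hxB hxA)

theorem mem_Ecyc_of_le_of_le {α : Type*} (H : α → ℝ) (q : α → α → ℝ) {k j m : ℕ} (hkj : k ≤ j)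
    (hjm : j ≤ m) {A : Set α} (hk : A ∈ Ecyc H q k) (hm : A ∈ Ecyc H q m) : A ∈ Ecyc H q j := by
  obtain ⟨x, hx⟩ := Setoid.nonempty_of_mem_partition (isPartition_Ecyc H q k) hk
  obtain ⟨B, ⟨hB, hxB⟩, -⟩ := (isPartition_Ecyc H q j).2 x
  rwa [(isCoarserThan_Ecyc H q hkj B hB A hk x hx hxB).antisymm
    (isCoarserThan_Ecyc H q hjm A hm B hB x hxB hx)]

theorem Hek_eq_of_le {α : Type*} (H : α → ℝ) (q : α → α → ℝ) {k m : ℕ} (hkm : k ≤ m)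
    {A : Set α} (hk : A ∈ Ecyc H q k) (hm : A ∈ Ecyc H q m) : Hek H q m A = Hek H q k A := by
  induction m, hkm using Nat.le_induction with
  | base => rfl
  | succ m hkm ih =>
    have hA := mem_Ecyc_of_le_of_le H q hkm m.le_succ hk hm
    exact (HeAux_EnextAux _ (isPartition_Ecyc H q m) hA hm).trans (ih hA)

/-- If a graph cycle `A` belongs to both `E^k` and `E^{k+1}`, then
`H_m^{k+1}(A) = H_e^{k+1}(A) = H_e^k(A)`; consequently, for every graph cycle `A ≠ S`,
`H_e^k(A) = H_e(A)` for every `k` with `A ∈ E^k`. -/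
theorem Hek_stable (H : S → ℝ) (q : S → S → ℝ)
    (hq : ∀ x y : S, 0 ≤ q x y ∧ q x y ≤ 1)
    (hsum : ∀ x : S, ∑ y ∈ Finset.univ.erase x, q x y ≤ 1)
    (hsym : ∀ x y : S, q x y = q y x)
    (hirr : ∀ x y : S, JoinedIn q Set.univ x y)
    :
    (∀ (k : ℕ) (A : Set S), A ∈ Ecyc H q k → A ∈ Ecyc H q (k + 1) →
        Hmk H q (k + 1) A = Hek H q (k + 1) A ∧ Hek H q (k + 1) A = Hek H q k A) ∧
      (∀ A : Set S, A ∈ GraphCycles H q → A ≠ Set.univ →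
        ∀ k : ℕ, A ∈ Ecyc H q k → Hek H q k A = HeC H q A) := by
  refine ⟨fun k A hk hk' => ?_, fun A _ _ k hk => ?_⟩
  · have h := Hek_eq_of_le H q k.le_succ hk hk'
    exact ⟨(HmAux_eq_HeAux _ (isPartition_Ecyc H q k) hk).trans h.symm, h⟩
  · refine le_antisymm (le_iSup₂_of_le k hk le_rfl) (iSup₂_le fun m hm => ?_)
    rcases le_total k m with h | h
    · exact (Hek_eq_of_le H q h hk hm).le
    · exact (Hek_eq_of_le H q h hm hk).ge

end MetropolisCycles
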